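/- Let 𝔞 be a finite-dimensional real Lie algebra with a nondegenerate invariant symmetric bilinear form K and a direct sum decomposition 𝔞 = 𝔞₀ ⊕ 𝔞₁ satisfying [𝔞₀,𝔞₀] ⊆ 𝔞₀, [𝔞₀,𝔞₁] ⊆ 𝔞₁, [𝔞₁,𝔞₁] ⊆ 𝔞₀ and K(𝔞₀,𝔞₁) = 0; let κ be the Killing form of 𝔞. Fix c ∈ ℝ and form the quadratic Lie algebra 𝔤 = ℝ[t]/(t²−c) ⊗ 𝔞 with generalized pseudometric V₊ = {u + tu : u ∈ 𝔞₁}. Then the generalized Ricci tensor with zero divergence, GRic_{V₊,0}(a₊,b₋) := −Tr_{V₊}(x ↦ P₊[P₋[x,b₋], a₊]), satisfies: (i) GRic_{V₊,0}(a₊, w) = 0 for every a₊ ∈ V₊ and every w ∈ 𝔞₀ (embedded in 𝔤 as w + t·0, which lies in V₋); (ii) GRic_{V₊,0}(u + tu, v − tv) = ((c−1)/2)·κ(u,v) for all u, v ∈ 𝔞₁ (note v − tv ∈ V₋). -/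

import Mathlib

/-! STATEMENT 2: the generalized Ricci tensor of the generalized pseudometric
`V₊ = {u + tu : u ∈ 𝔞₁}` in the quadratic Lie algebra `𝔤 = ℝ[t]/(t²−c) ⊗ 𝔞`
(modeled on `𝔞 × 𝔞`, with `(u, u′)` standing for `u + t u′`). -/

section TwistedDouble

variable {𝔞 : Type*} [LieRing 𝔞] [LieAlgebra ℝ 𝔞]

/-- The Lie bracket of `𝔤 = ℝ[t]/(t²−c) ⊗ 𝔞`, as a bilinear map on `𝔞 × 𝔞`:
`[u+tu′, v+tv′] = ([u,v] + c[u′,v′]) + t([u,v′] + [u′,v])`. -/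
noncomputable def twistBracket (c : ℝ) : (𝔞 × 𝔞) →ₗ[ℝ] (𝔞 × 𝔞) →ₗ[ℝ] (𝔞 × 𝔞) :=
  LinearMap.mk₂ ℝ
    (fun x y => (⁅x.1, y.1⁆ + c • ⁅x.2, y.2⁆, ⁅x.1, y.2⁆ + ⁅x.2, y.1⁆))
    (fun m₁ m₂ n => by
      simp only [Prod.fst_add, Prod.snd_add, add_lie, smul_add, Prod.mk_add_mk, Prod.mk.injEq]
      exact ⟨by abel, by abel⟩)
    (fun t m n => by
      simp only [Prod.smul_fst, Prod.smul_snd, smul_lie, Prod.smul_mk, smul_add, Prod.mk.injEq]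
      refine ⟨by rw [smul_comm], ?_⟩
      try rfl
      try trivial)
    (fun m n₁ n₂ => by
      simp only [Prod.fst_add, Prod.snd_add, lie_add, smul_add, Prod.mk_add_mk, Prod.mk.injEq]
      exact ⟨by abel, by abel⟩)
    (fun t m n => by
      simp only [Prod.smul_fst, Prod.smul_snd, lie_smul, Prod.smul_mk, smul_add, Prod.mk.injEq]
      refine ⟨by rw [smul_comm], ?_⟩
      try rfl
      try trivial)

/-- The invariant pairing of `𝔤 = ℝ[t]/(t²−c) ⊗ 𝔞`:
`⟨u+tu′, v+tv′⟩ = K(u,v′) + K(u′,v)`. -/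
noncomputable def twistForm (K : LinearMap.BilinForm ℝ 𝔞) :
    LinearMap.BilinForm ℝ (𝔞 × 𝔞) :=
  LinearMap.mk₂ ℝ (fun x y => K x.1 y.2 + K x.2 y.1)
    (fun m₁ m₂ n => by
      simp only [Prod.fst_add, Prod.snd_add, map_add, LinearMap.add_apply]
      ring)
    (fun t m n => by
      simp only [Prod.smul_fst, Prod.smul_snd, map_smul, LinearMap.smul_apply, smul_eq_mul]
      ring)
    (fun m n₁ n₂ => by
      simp only [Prod.fst_add, Prod.snd_add, map_add]
      ring)
    (fun t m n => by
      simp only [Prod.smul_fst, Prod.smul_snd, map_smul, smul_eq_mul]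
      ring)

/-- The generalized pseudometric `V₊ = {(u, u) : u ∈ 𝔞₁} ⊆ 𝔤`, i.e. `V₊ = (1+t)𝔞₁`. -/
noncomputable def Vplus (a1 : Submodule ℝ 𝔞) : Submodule ℝ (𝔞 × 𝔞) :=
  a1.map (LinearMap.prod LinearMap.id LinearMap.id)

/-- The generalized Ricci tensor with zero divergence:
`GRic_{V₊,0}(a₊,b₋) = −Tr_{V₊}(x ↦ P₊[P₋[x,b₋],a₊])`, where `P₊` is the
projection onto `V₊` (along `V₋ = V₊^⊥`) and `P₋ = id − P₊`. -/
noncomputable def gric (c : ℝ) (a1 : Submodule ℝ 𝔞)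
    (Pp : (𝔞 × 𝔞) →ₗ[ℝ] (𝔞 × 𝔞)) (hPp : ∀ x, Pp x ∈ Vplus a1)
    (a b : 𝔞 × 𝔞) : ℝ :=
  - LinearMap.trace ℝ (Vplus a1)
      ((Pp ∘ₗ (twistBracket c).flip a ∘ₗ (LinearMap.id - Pp) ∘ₗ
          (twistBracket c).flip b).restrict (fun x _ => hPp _))

end TwistedDouble

/-- Adjoint endomorphisms with respect to a nondegenerate bilinear form have the same trace. -/
theorem LinearMap.BilinForm.trace_eq_of_isAdjointPair {k V : Type*} [Field k] [AddCommGroup V]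
    [Module k V] [FiniteDimensional k V] {B : LinearMap.BilinForm k V} (hB : B.Nondegenerate)
    {f g : V →ₗ[k] V} (hfg : ∀ x y, B (f x) y = B x (g y)) :
    LinearMap.trace k V f = LinearMap.trace k V g := by
  rw [← LinearMap.trace_transpose' g, ← LinearMap.trace_conj' f (B.toDual hB)]
  congr 1
  ext φ y
  obtain ⟨x, rfl⟩ := (B.toDual hB).surjective φ
  simp [LinearEquiv.conj_apply, Module.Dual.transpose_apply, LinearMap.BilinForm.toDual_def, hfg]

section SymmetricDecomposition

variable {𝔞 : Type*} [LieRing 𝔞] [LieAlgebra ℝ 𝔞]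
  {K : LinearMap.BilinForm ℝ 𝔞} {a0 a1 : Submodule ℝ 𝔞}

/-- For `v ∈ 𝔞₁`, the Killing form is twice the trace of `ad u ∘ ad v` over `𝔞₁`. -/
theorem killingForm_eq_two_mul_trace_projection [FiniteDimensional ℝ 𝔞]
    (hK : K.Nondegenerate)
    (hKsymm : ∀ x y, K x y = K y x)
    (hKinv : ∀ x y z : 𝔞, K ⁅x, y⁆ z + K y ⁅x, z⁆ = 0) (hcompl : IsCompl a0 a1)
    (h01 : ∀ x ∈ a0, ∀ y ∈ a1, ⁅x, y⁆ ∈ a1) (h11 : ∀ x ∈ a1, ∀ y ∈ a1, ⁅x, y⁆ ∈ a0)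
    (horth : ∀ x ∈ a0, ∀ y ∈ a1, K x y = 0) (u : 𝔞) {v : 𝔞} (hv : v ∈ a1) :
    killingForm ℝ 𝔞 u v = 2 * LinearMap.trace ℝ 𝔞
      ((LieAlgebra.ad ℝ 𝔞 u ∘ₗ LieAlgebra.ad ℝ 𝔞 v) ∘ₗ a1.projection a0 hcompl.symm) := by
  set P := a1.projection a0 hcompl.symm
  set U := LieAlgebra.ad ℝ 𝔞 u
  set V := LieAlgebra.ad ℝ 𝔞 v
  have hP1 : ∀ x, P x ∈ a1 := Submodule.projection_apply_mem hcompl.symm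
  have hP0 : ∀ x, x - P x ∈ a0 := fun x ↦ by
    rw [← Submodule.projection_apply_eq_zero_iff hcompl.symm, map_sub,
      Submodule.projection_apply_of_mem_left hcompl.symm (hP1 x), sub_self]
  have hPV : ∀ x, P (V x) = V (x - P x) := fun x ↦ by
    have h1 : V (x - P x) ∈ a1 := by
      rw [LieAlgebra.ad_apply, ← lie_skew]
      exact a1.neg_mem (h01 _ (hP0 x) _ hv)
    have h0 : V (P x) ∈ a0 := h11 _ hv _ (hP1 x)
    calc P (V x) = P (V (x - P x)) + P (V (P x)) := by rw [← map_add, ← map_add, sub_add_cancel]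
      _ = V (x - P x) := by
        rw [Submodule.projection_apply_of_mem_left hcompl.symm h1,
          (Submodule.projection_apply_eq_zero_iff hcompl.symm).2 h0, add_zero]
  have hPadj : ∀ x y, K (P x) y = K x (P y) := fun x y ↦ by
    have h1 : K (y - P y) (P x) = 0 := horth _ (hP0 y) _ (hP1 x)
    have h2 : K (x - P x) (P y) = 0 := horth _ (hP0 x) _ (hP1 y)
    rw [hKsymm, map_sub, sub_eq_zero] at h1
    rw [map_sub, LinearMap.sub_apply, sub_eq_zero] at h2
    rw [h1, h2]
  have hadj : LinearMap.trace ℝ 𝔞 ((U ∘ₗ V) ∘ₗ P) = LinearMap.trace ℝ 𝔞 (P ∘ₗ V ∘ₗ U) :=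
    LinearMap.BilinForm.trace_eq_of_isAdjointPair hK fun x y ↦ by
      have h1 := hKinv u (V (P x)) y
      have h2 := hKinv v (P x) (U y)
      have h3 := hPadj x (V (U y))
      simp only [U, V, LieAlgebra.ad_apply, LinearMap.comp_apply] at h1 h2 h3 ⊢
      linarith
  have hcyc : LinearMap.trace ℝ 𝔞 (P ∘ₗ V ∘ₗ U) = LinearMap.trace ℝ 𝔞 (U ∘ₗ P ∘ₗ V) :=
    LinearMap.trace_comp_comm' U (P ∘ₗ V)
  have hsplit : U ∘ₗ P ∘ₗ V = U ∘ₗ V - (U ∘ₗ V) ∘ₗ P := by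
    ext x
    simp [hPV]
  rw [hsplit, map_sub] at hcyc
  rw [killingForm_apply_apply]
  linarith

/-- The projection onto `V₊` along `V₊^⊥` is `(p, q) ↦ (1 + t) P₁((p + q) / 2)`, where `P₁` is the
projection onto `𝔞₁` along `𝔞₀`. -/
theorem apply_eq_projection_of_mem_Vplus (hK : K.Nondegenerate)
    (hKsymm : ∀ x y, K x y = K y x) (hcompl : IsCompl a0 a1)
    (horth : ∀ x ∈ a0, ∀ y ∈ a1, K x y = 0) {Pp : (𝔞 × 𝔞) →ₗ[ℝ] (𝔞 × 𝔞)}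
    (hPp : ∀ x, Pp x ∈ Vplus a1)
    (hPm : ∀ x, x - Pp x ∈ LinearMap.BilinForm.orthogonal (twistForm K) (Vplus a1)) (p q : 𝔞) :
    Pp (p, q) = (a1.projection a0 hcompl.symm ((2⁻¹ : ℝ) • (p + q)),
      a1.projection a0 hcompl.symm ((2⁻¹ : ℝ) • (p + q))) := by
  set P := a1.projection a0 hcompl.symm
  have hP1 : ∀ x, P x ∈ a1 := Submodule.projection_apply_mem hcompl.symm
  have hP0 : ∀ x, x - P x ∈ a0 := fun x ↦ by
    rw [← Submodule.projection_apply_eq_zero_iff hcompl.symm, map_sub,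
      Submodule.projection_apply_of_mem_left hcompl.symm (hP1 x), sub_self]
  obtain ⟨z, hz, hzP⟩ := hPp (p, q)
  replace hzP : Pp (p, q) = (z, z) := hzP.symm
  set m := (2⁻¹ : ℝ) • (p + q) with hm
  suffices h : z - P m = 0 by rw [hzP, sub_eq_zero.1 h]
  refine hK.1 _ fun y ↦ ?_
  have hd : z - P m ∈ a1 := a1.sub_mem hz (hP1 m)
  have hy0 : K (z - P m) (y - P y) = 0 := by rw [hKsymm]; exact horth _ (hP0 y) _ hd
  have hm0 : K (m - P m) (P y) = 0 := horth _ (hP0 m) _ (hP1 y)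
  have hort : K (P y) (q - z) + K (P y) (p - z) = 0 := by
    have h := (LinearMap.BilinForm.mem_orthogonal_iff.1 (hPm (p, q))) (P y, P y)
      ⟨P y, hP1 y, rfl⟩
    rw [hzP] at h
    exact h
  rw [hKsymm, hKsymm (P y)] at hort
  simp only [map_sub, map_add, map_smul, LinearMap.sub_apply, LinearMap.add_apply,
    LinearMap.smul_apply, smul_eq_mul, hm] at hort hm0 hy0 ⊢
  linarith

/-- The trace defining `GRic` can be computed on `𝔞₁` through `u ↦ u + tu`. -/
theorem gric_eq_neg_trace_comp_projection [FiniteDimensional ℝ 𝔞] (hcompl : IsCompl a0 a1) {c : ℝ}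
    {Pp : (𝔞 × 𝔞) →ₗ[ℝ] (𝔞 × 𝔞)} (hPp : ∀ x, Pp x ∈ Vplus a1) {a b : 𝔞 × 𝔞}
    {S : 𝔞 →ₗ[ℝ] 𝔞} (hS1 : ∀ x ∈ a1, S x ∈ a1)
    (hS : ∀ x ∈ a1, Pp (twistBracket c (twistBracket c (x, x) b -
      Pp (twistBracket c (x, x) b)) a) = (S x, S x)) :
    gric c a1 Pp hPp a b = -LinearMap.trace ℝ 𝔞 (S ∘ₗ a1.projection a0 hcompl.symm) := by
  set P := a1.projection a0 hcompl.symm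
  have hP1 : ∀ x, P x ∈ a1 := Submodule.projection_apply_mem hcompl.symm
  let e : a1 ≃ₗ[ℝ] Vplus a1 :=
    Submodule.equivMapOfInjective (LinearMap.prod LinearMap.id LinearMap.id)
      (fun x y h ↦ (Prod.mk.inj h).1) a1
  rw [gric, ← LinearMap.trace_restrict_eq_of_forall_mem a1 (S ∘ₗ P) (fun x ↦ hS1 _ (hP1 x)),
    ← LinearMap.trace_conj' _ e]
  congr 2
  ext1 y
  obtain ⟨x, rfl⟩ := e.surjective y
  apply Subtype.ext
  rw [LinearEquiv.conj_apply_apply, LinearEquiv.symm_apply_apply]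
  refine (hS x x.2).trans ?_
  have hx : P x = x := Submodule.projection_apply_of_mem_left hcompl.symm x.2
  change _ = (S (P x), S (P x))
  rw [hx]

end SymmetricDecomposition

/-- Lemma `algebraic_ric`: in the above setting, with `P₊` the
projection onto `V₊` along `V₋ = V₊^⊥`,
(i) `GRic_{V₊,0}(a₊, w) = 0` for `a₊ ∈ V₊` and `w ∈ 𝔞₀` (embedded as `w + t·0`);
(ii) `GRic_{V₊,0}(u+tu, v−tv) = ((c−1)/2)·κ(u,v)` for `u, v ∈ 𝔞₁`. -/
theorem stmt_2 {𝔞 : Type*} [LieRing 𝔞] [LieAlgebra ℝ 𝔞] [FiniteDimensional ℝ 𝔞]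
    (K : LinearMap.BilinForm ℝ 𝔞)
    (hKsymm : ∀ x y, K x y = K y x)
    (hKnd : ∀ x, (∀ y, K x y = 0) → x = 0)
    (hKinv : ∀ x y z : 𝔞, K ⁅x, y⁆ z + K y ⁅x, z⁆ = 0)
    (a0 a1 : Submodule ℝ 𝔞)
    (hcompl : IsCompl a0 a1)
    (h00 : ∀ x ∈ a0, ∀ y ∈ a0, ⁅x, y⁆ ∈ a0)
    (h01 : ∀ x ∈ a0, ∀ y ∈ a1, ⁅x, y⁆ ∈ a1)
    (h11 : ∀ x ∈ a1, ∀ y ∈ a1, ⁅x, y⁆ ∈ a0)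
    (horth : ∀ x ∈ a0, ∀ y ∈ a1, K x y = 0)
    (c : ℝ)
    (Pp : (𝔞 × 𝔞) →ₗ[ℝ] (𝔞 × 𝔞))
    (hPp : ∀ x, Pp x ∈ Vplus a1)
    (hPm : ∀ x, x - Pp x ∈ LinearMap.BilinForm.orthogonal (twistForm K) (Vplus a1)) :
    (∀ a ∈ Vplus a1, ∀ w ∈ a0, gric c a1 Pp hPp a (w, 0) = 0) ∧
    (∀ u ∈ a1, ∀ v ∈ a1,
      gric c a1 Pp hPp (u, u) (v, -v) = ((c - 1) / 2) * killingForm ℝ 𝔞 u v) := by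
  have hK : K.Nondegenerate :=
    ⟨hKnd, fun x h ↦ hKnd x fun _ ↦ by rw [hKsymm]; exact h _⟩
  have hproj := apply_eq_projection_of_mem_Vplus hK hKsymm hcompl horth hPp hPm
  have hP1 : ∀ x ∈ a1, a1.projection a0 hcompl.symm x = x := fun x hx ↦
    Submodule.projection_apply_of_mem_left hcompl.symm hx
  have hP0 : ∀ x ∈ a0, a1.projection a0 hcompl.symm x = 0 := fun x hx ↦
    (Submodule.projection_apply_eq_zero_iff hcompl.symm).2 hx
  have hdiag : ∀ x ∈ a1, Pp (x, x) = (x, x) := fun x hx ↦ by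
    rw [hproj, ← two_smul ℝ x, inv_smul_smul₀ two_ne_zero, hP1 x hx]
  constructor
  · intro a ha w hw
    rw [gric_eq_neg_trace_comp_projection hcompl hPp (S := 0) (fun _ _ ↦ a1.zero_mem)]
    · simp
    · intro x hx
      have hxw : ⁅x, w⁆ ∈ a1 := by
        rw [← lie_skew]
        exact a1.neg_mem (h01 w hw x hx)
      have hb : twistBracket c (x, x) (w, 0) = (⁅x, w⁆, ⁅x, w⁆) := by simp [twistBracket]
      simp [hb, hdiag _ hxw]
      rfl
  · intro u hu v hv
    rw [gric_eq_neg_trace_comp_projection hcompl hPp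
      (S := (1 - c) • (LieAlgebra.ad ℝ 𝔞 u ∘ₗ LieAlgebra.ad ℝ 𝔞 v)),
      killingForm_eq_two_mul_trace_projection hK hKsymm hKinv hcompl h01 h11 horth u hv,
      LinearMap.smul_comp, map_smul, smul_eq_mul]
    · ring
    · intro x hx
      refine a1.smul_mem _ ?_
      rw [LinearMap.comp_apply, LieAlgebra.ad_apply, ← lie_skew]
      exact a1.neg_mem (h01 _ (h11 v hv x hx) u hu)
    · intro x hx
      have hy : (1 - c) • ⁅x, v⁆ ∈ a0 := a0.smul_mem _ (h11 x hx v hv)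
      have hb : twistBracket c (x, x) (v, -v) = ((1 - c) • ⁅x, v⁆, 0) := by
        simp [twistBracket, sub_eq_add_neg, add_smul, -lie_skew]
      have hPb : Pp ((1 - c) • ⁅x, v⁆, 0) = 0 := by
        rw [hproj, add_zero, hP0 _ (a0.smul_mem _ hy), Prod.mk_zero_zero]
      have ha : twistBracket c ((1 - c) • ⁅x, v⁆, 0) (u, u) =
          (⁅(1 - c) • ⁅x, v⁆, u⁆, ⁅(1 - c) • ⁅x, v⁆, u⁆) := by simp [twistBracket]
      have hadj : ⁅⁅x, v⁆, u⁆ = ⁅u, ⁅v, x⁆⁆ := by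
        rw [← lie_skew u, ← lie_skew x v, neg_lie]
      rw [hb, hPb, sub_zero, ha, hdiag _ (h01 _ hy u hu)]
      simp [hadj]
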